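/- Let q be a prime power, n = q − 1, α ∈ F_q a primitive element, k ≤ n, and p ∈ ℕ with p ≥ 1 and p ∣ n. For every v ∈ F_q^n, the vector PER_p(v) vanishes at every position j with (n/p) ∤ j (a set of exactly n − p positions), and if additionally p ≥ n − k, then PER_p(v) − v ∈ RS(F_q; n, k). Hence the periodicity projection PER_p is an instance of the re-encoding map with σ = n − p and J = { j : (n/p) ∤ j }: PER_p(v) = v + c̃ for a codeword c̃ ∈ RS(F_q; n, k) such that v + c̃ vanishes on J. -/

import Mathlib

open Finset

/-- The Discrete Fourier Transform: `(dft n α v) j = ∑ i, v i * α ^ (j * i)`. -/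
def dft {F : Type*} [Field F] (n : ℕ) (α : F) (v : Fin n → F) : Fin n → F :=
  fun j => ∑ i : Fin n, v i * α ^ (j.val * i.val)

/-- The Inverse Discrete Fourier Transform:
`(idft n α V) j = n⁻¹ * ∑ i, V i * α ^ (-(j * i))`. -/
def idft {F : Type*} [Field F] (n : ℕ) (α : F) (V : Fin n → F) : Fin n → F :=
  fun j => (n : F)⁻¹ * ∑ i : Fin n, V i * (α ^ (j.val * i.val))⁻¹

/-- The primitive Reed--Solomon code of length `n` and dimension `k`: the set of
IDFTs of frequency-domain vectors whose last `n - k` components vanish. -/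
def RSCode {F : Type*} [Field F] (n k : ℕ) (α : F) : Set (Fin n → F) :=
  { c | ∃ C : Fin n → F, (∀ j : Fin n, k ≤ j.val → C j = 0) ∧ c = idft n α C }

/-- The periodicity projection `PER_p` : it maps `v` to the IDFT of the `p`-periodic
frequency-domain vector `(T, …, T)` (`n/p` copies) whose template vector
`T = (V_{n-p}, …, V_{n-1})` consists of the last `p` components of `V = DFT(v)`. -/
def per {F : Type*} [Field F] (n p : ℕ) (hp : 0 < p) (hpn : p ∣ n) (α : F)
    (v : Fin n → F) : Fin n → F :=
  idft n α fun j =>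
    dft n α v ⟨n - p + j.val % p, by
      have h0 := j.isLt
      have h1 := Nat.mod_lt j.val hp
      have h2 := Nat.le_of_dvd (by omega) hpn
      omega⟩

open Finset

theorem sum_range_add_of_periodic {M : Type*} [AddCommMonoid M] {n : ℕ} {g : ℕ → M}
    (hg : Function.Periodic g n) (s : ℕ) :
    ∑ i ∈ range n, g (i + s) = ∑ i ∈ range n, g i := by
  induction s with
  | zero => rfl
  | succ s ih =>
    rw [← ih]
    cases n with
    | zero => simp
    | succ m =>
      rw [sum_range_succ, sum_range_succ' (fun i => g (i + s))]
      have h := hg s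
      rw [show m + (s + 1) = s + (m + 1) by omega, h, zero_add]
      simp only [add_assoc, add_comm 1 s]

theorem sum_periodic_mul_pow_eq_zero {F : Type*} [Field F] {n p : ℕ} (hpn : p ∣ n) (T : ℕ → F)
    {β : F} (hβn : β ^ n = 1) (hβp : β ^ p ≠ 1) :
    ∑ i ∈ range n, T (i % p) * β ^ i = 0 := by
  have hper : Function.Periodic (fun i => T (i % p) * β ^ i) n := by
    obtain ⟨m, rfl⟩ := hpn
    intro i
    simp [pow_add, hβn]
  have h := sum_range_add_of_periodic hper p
  simp only [Nat.add_mod_right, pow_add, ← mul_assoc] at h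
  rw [← sum_mul] at h
  by_contra hS
  exact hβp (mul_left_cancel₀ hS (h.trans (mul_one _).symm))

theorem idft_dft {F : Type*} [Field F] {n : ℕ} {α : F} (hα : IsPrimitiveRoot α n)
    (hn : (n : F) ≠ 0) (v : Fin n → F) : idft n α (dft n α v) = v := by
  funext j
  have hn0 : 0 < n := j.pos
  have hα0 : α ≠ 0 := hα.ne_zero hn0.ne'
  have horth (l : Fin n) : ∑ i : Fin n, α ^ (i.val * l.val) * (α ^ (j.val * i.val))⁻¹
      = if l = j then (n : F) else 0 := by
    split_ifs with h
    · subst h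
      simp [mul_comm l.val, hα0]
    · set β : F := α ^ l.val / α ^ j.val with hβ
      have hβ1 : β ≠ 1 := by
        intro h1
        rw [hβ, div_eq_one_iff_eq (pow_ne_zero _ hα0)] at h1
        exact h (Fin.ext (hα.pow_inj l.isLt j.isLt h1))
      have hβn : β ^ n = 1 := by
        rw [hβ, div_pow, ← pow_mul, ← pow_mul, mul_comm, pow_mul, mul_comm j.val, pow_mul]
        simp [hα.pow_eq_one]
      have hterm (i : Fin n) :
          α ^ (i.val * l.val) * (α ^ (j.val * i.val))⁻¹ = β ^ i.val := by
        rw [hβ, div_pow, ← pow_mul, ← pow_mul, mul_comm i.val, div_eq_mul_inv]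
      simp_rw [hterm]
      rw [Fin.sum_univ_eq_sum_range (fun i => β ^ i), geom_sum_eq hβ1, hβn]
      simp
  simp only [idft, dft, sum_mul]
  rw [sum_comm]
  simp_rw [mul_assoc, ← mul_sum, horth]
  simp [mul_left_comm _ (v j), hn]

theorem idft_sub {F : Type*} [Field F] (n : ℕ) (α : F) (V W : Fin n → F) :
    idft n α (V - W) = idft n α V - idft n α W := by
  funext j
  simp [idft, sub_mul, mul_sub]

theorem per_apply_eq_zero {F : Type*} [Field F] {n p : ℕ} (hp : 0 < p) (hpn : p ∣ n) {α : F}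
    (hα : IsPrimitiveRoot α n) (v : Fin n → F) (j : Fin n) (hj : ¬ n / p ∣ j.val) :
    per n p hp hpn α v j = 0 := by
  have hβn : (α ^ j.val)⁻¹ ^ n = 1 := by
    rw [inv_pow, ← pow_mul, mul_comm, pow_mul, hα.pow_eq_one, one_pow, inv_one]
  have hβp : (α ^ j.val)⁻¹ ^ p ≠ 1 := by
    rw [inv_pow, ← pow_mul, Ne, inv_eq_one, hα.pow_eq_one_iff_dvd]
    exact fun h => hj ((Nat.div_dvd_iff_dvd_mul hpn hp).2 (mul_comm j.val p ▸ h))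
  have h := sum_periodic_mul_pow_eq_zero hpn
    (fun r => ∑ l : Fin n, v l * α ^ ((n - p + r) * l.val)) hβn hβp
  rw [← Fin.sum_univ_eq_sum_range
    (fun i => (∑ l : Fin n, v l * α ^ ((n - p + i % p) * l.val)) * (α ^ j.val)⁻¹ ^ i)] at h
  simp only [inv_pow, ← pow_mul] at h
  simp only [per, idft, dft, h, mul_zero]

theorem card_filter_not_div_dvd {n p : ℕ} (hn : 0 < n) (hpn : p ∣ n) :
    (univ.filter (fun j : Fin n => ¬ (n / p) ∣ j.val)).card = n - p := by
  obtain ⟨m, rfl⟩ := hpn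
  have hp : 0 < p := Nat.pos_of_mul_pos_right hn
  have hm : 0 < m := Nat.pos_of_mul_pos_left hn
  rw [Nat.mul_div_cancel_left _ hp]
  have hdvd : (univ.filter (fun j : Fin (p * m) => m ∣ j.val)).card = p := by
    conv_rhs => rw [← card_range p]
    refine card_bij (fun j _ => j.val / m) ?_ ?_ ?_
    · intro j _
      exact mem_range.2 ((Nat.div_lt_iff_lt_mul hm).2 j.isLt)
    · intro a ha b hb hab
      exact Fin.ext ((Nat.div_left_inj (mem_filter.1 ha).2 (mem_filter.1 hb).2).1 hab)
    · intro b hb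
      exact ⟨⟨b * m, Nat.mul_lt_mul_of_pos_right (mem_range.1 hb) hm⟩, by simp,
        Nat.mul_div_cancel _ hm⟩
  have h := card_filter_add_card_filter_not (s := univ) (fun j : Fin (p * m) => m ∣ j.val)
  rw [hdvd, card_univ, Fintype.card_fin] at h
  omega

theorem per_sub_mem_RSCode {F : Type*} [Field F] {n k p : ℕ} (hp : 0 < p) (hpn : p ∣ n) {α : F}
    (hα : IsPrimitiveRoot α n) (hn : (n : F) ≠ 0) (hkp : n - k ≤ p) (v : Fin n → F) :
    per n p hp hpn α v - v ∈ RSCode n k α := by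
  have hidft : per n p hp hpn α v - v = idft n α (_ - dft n α v) :=
    ((idft_sub n α _ _).trans (congrArg (per n p hp hpn α v - ·) (idft_dft hα hn v))).symm
  refine ⟨_, fun j hj => ?_, hidft⟩
  have hmod : n - p + j.val % p = j.val := by
    obtain ⟨c, hc⟩ := Nat.dvd_sub hpn (dvd_refl p)
    obtain ⟨r, hr⟩ : ∃ r, j.val = n - p + r := ⟨j.val - (n - p), by omega⟩
    have hrp : r < p := by have := j.isLt; omega
    rw [hr, hc, Nat.mul_add_mod, Nat.mod_eq_of_lt hrp]
  simp only [Pi.sub_apply, hmod, sub_self]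

/-- For every `v ∈ F_q^n`, `PER_p(v)` vanishes at every position `j` with `(n/p) ∤ j`
(a set of exactly `n - p` positions), and if additionally `p ≥ n - k`, then
`PER_p(v) - v ∈ RS(F_q; n, k)`; hence `PER_p` is an instance of the re-encoding map
with `σ = n - p` and `J = {j : (n/p) ∤ j}`: `PER_p(v) = v + c̃` for a codeword
`c̃ ∈ RS(F_q; n, k)` such that `v + c̃` vanishes on `J`. -/
theorem statement_3 {F : Type*} [Field F] [Fintype F]
    (n k : ℕ) (hn : n = Fintype.card F - 1)
    (α : F) (hα : orderOf α = n) (hk : k ≤ n)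
    (p : ℕ) (hp : 0 < p) (hpn : p ∣ n)
    (v : Fin n → F) :
    (∀ j : Fin n, ¬ (n / p) ∣ j.val → per n p hp hpn α v j = 0) ∧
    (Finset.univ.filter (fun j : Fin n => ¬ (n / p) ∣ j.val)).card = n - p ∧
    (n - k ≤ p →
      per n p hp hpn α v - v ∈ RSCode n k α ∧
      ∃ ct ∈ RSCode n k α, per n p hp hpn α v = v + ct ∧
        ∀ j : Fin n, ¬ (n / p) ∣ j.val → (v + ct) j = 0) := by
  have hcard : 1 < Fintype.card F := Fintype.one_lt_card
  have hn0 : 0 < n := by omega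
  have hprim : IsPrimitiveRoot α n := hα ▸ IsPrimitiveRoot.orderOf α
  have hnF : (n : F) ≠ 0 := by
    rw [hn, Nat.cast_sub hcard.le, Nat.cast_card_eq_zero]
    simp
  have hzero := per_apply_eq_zero hp hpn hprim v
  refine ⟨hzero, card_filter_not_div_dvd hn0 hpn, fun hkp => ?_⟩
  have hmem := per_sub_mem_RSCode hp hpn hprim hnF hkp v
  refine ⟨hmem, _, hmem, (add_sub_cancel v _).symm, fun j hj => ?_⟩
  rw [add_sub_cancel]
  exact hzero j hj
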